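/- Let (X,d,T) be a topological dynamical system, φ ∈ C(X,ℝ), and K ⊆ M(X,T) a nonempty closed subset. Then P(G_K, φ) ≤ inf{ h(T,μ) + ∫φ dμ : μ ∈ K }, where G_K = {x ∈ X : A(L_n x) = K} is the set of points whose empirical measures have exactly K as their set of accumulation points. -/

import Mathlib

open MeasureTheory Filter Topology Set
open scoped ENNReal

noncomputable section

/-- Birkhoff sum `S_m φ(x) = Σ_{i=0}^{m-1} φ(T^i x)`. -/
def birkhoffS {X : Type*} (T : X → X) (φ : X → ℝ) (m : ℕ) (x : X) : ℝ :=
  ∑ i ∈ Finset.range m, φ (T^[i] x)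

/-- Bowen ball `B_m(x,ε) = {y : max_{0 ≤ i < m} D(T^i x, T^i y) ≤ ε}`, with respect
to a distance function `D`. -/
def bowenBallD {X : Type*} (D : X → X → ℝ) (T : X → X) (x : X) (m : ℕ) (ε : ℝ) : Set X :=
  {y | ∀ i < m, D (T^[i] x) (T^[i] y) ≤ ε}

/-- `C` is an admissible (finite or countable) cover of `Z` by Bowen balls
`B_m(x,ε)` with `m ≥ n`. -/
def covOK {X : Type*} (D : X → X → ℝ) (T : X → X) (Z : Set X) (n : ℕ) (ε : ℝ)
    (C : Set (X × ℕ)) : Prop :=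
  C.Countable ∧ (∀ p ∈ C, n ≤ p.2) ∧ Z ⊆ ⋃ p ∈ C, bowenBallD D T p.1 p.2 ε

/-- `M(Z,t,φ,n,ε) = inf_C Σ exp(-t m + sup_{y ∈ B_m(x,ε)} S_m φ(y))`. -/
def Mpre {X : Type*} (D : X → X → ℝ) (T : X → X) (Z : Set X) (t : ℝ) (φ : X → ℝ)
    (n : ℕ) (ε : ℝ) : ℝ≥0∞ :=
  ⨅ (C : Set (X × ℕ)) (_ : covOK D T Z n ε C),
    ∑' p : C, ENNReal.ofReal
      (Real.exp (-t * ((p : X × ℕ).2 : ℝ) +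
        sSup (birkhoffS T φ (p : X × ℕ).2 '' bowenBallD D T (p : X × ℕ).1 (p : X × ℕ).2 ε)))

/-- `M(Z,t,φ,ε) = lim_n M(Z,t,φ,n,ε)` (the quantity is nondecreasing in `n`). -/
def Mlim {X : Type*} (D : X → X → ℝ) (T : X → X) (Z : Set X) (t : ℝ) (φ : X → ℝ)
    (ε : ℝ) : ℝ≥0∞ :=
  ⨆ n : ℕ, Mpre D T Z t φ n ε

/-- `P(Z,φ,ε)`: the critical value of `t ↦ M(Z,t,φ,ε)`. -/
def pressAt {X : Type*} (D : X → X → ℝ) (T : X → X) (Z : Set X) (φ : X → ℝ)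
    (ε : ℝ) : EReal :=
  sInf {s : EReal | ∃ t : ℝ, s = (t : EReal) ∧ Mlim D T Z t φ ε = 0}

/-- The Pesin–Pitskel topological pressure `P(Z,φ) = lim_{ε → 0⁺} P(Z,φ,ε)`
of an arbitrary subset `Z`, with respect to a distance function `D`. -/
def pressD {X : Type*} (D : X → X → ℝ) (T : X → X) (Z : Set X) (φ : X → ℝ) : EReal :=
  limsup (fun ε : ℝ => pressAt D T Z φ ε) (𝓝[>] 0)

/-- Topological pressure of a subset of a metric space. -/
def pressure {X : Type*} [MetricSpace X] (T : X → X) (Z : Set X) (φ : X → ℝ) : EReal :=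
  pressD (fun a b => dist a b) T Z φ

/-- `N(Z,t,ψ,n,ε) = inf_C Σ exp(-t · sup_{y ∈ B_m(x,ε)} S_m ψ(y))`
(the BS-dimension Carathéodory sum). -/
def Npre {X : Type*} (D : X → X → ℝ) (T : X → X) (Z : Set X) (t : ℝ) (ψ : X → ℝ)
    (n : ℕ) (ε : ℝ) : ℝ≥0∞ :=
  ⨅ (C : Set (X × ℕ)) (_ : covOK D T Z n ε C),
    ∑' p : C, ENNReal.ofReal
      (Real.exp (-t *
        sSup (birkhoffS T ψ (p : X × ℕ).2 '' bowenBallD D T (p : X × ℕ).1 (p : X × ℕ).2 ε)))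

/-- `BS(Z,ψ,ε)`: critical value of `t ↦ lim_n N(Z,t,ψ,n,ε)`. -/
def BSat {X : Type*} (D : X → X → ℝ) (T : X → X) (Z : Set X) (ψ : X → ℝ)
    (ε : ℝ) : EReal :=
  sInf {s : EReal | ∃ t : ℝ, s = (t : EReal) ∧ (⨆ n : ℕ, Npre D T Z t ψ n ε) = 0}

/-- The BS-dimension `BS(Z,ψ) = lim_{ε → 0⁺} BS(Z,ψ,ε)` of Barreira–Schmeling. -/
def BSdimD {X : Type*} (D : X → X → ℝ) (T : X → X) (Z : Set X) (ψ : X → ℝ) : EReal :=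
  limsup (fun ε : ℝ => BSat D T Z ψ ε) (𝓝[>] 0)

/-- BS-dimension in a metric space. -/
def BSdim {X : Type*} [MetricSpace X] (T : X → X) (Z : Set X) (ψ : X → ℝ) : EReal :=
  BSdimD (fun a b => dist a b) T Z ψ

end
open MeasureTheory Filter Topology Set
open scoped ENNReal

noncomputable section

/-- The `n`-th (here: `(n+1)`-st) empirical measure
`L_{n+1} x = (1/(n+1)) Σ_{k=0}^{n} δ_{T^k x}` as a Borel probability measure. -/
noncomputable def empPM {X : Type*} [MeasurableSpace X] (T : X → X) (x : X) (n : ℕ) :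
    ProbabilityMeasure X :=
  ⟨((n + 1 : ℝ≥0∞))⁻¹ • ∑ k ∈ Finset.range (n + 1), Measure.dirac (T^[k] x), by
    constructor
    rw [Measure.smul_apply, Measure.coe_finset_sum, Finset.sum_apply]
    simp only [measure_univ, Finset.sum_const, Finset.card_range, nsmul_eq_mul, mul_one]
    rw [smul_eq_mul]
    have h1 : ((n : ℝ≥0∞) + 1) ≠ 0 := by simp
    have h2 : ((n : ℝ≥0∞) + 1) ≠ ⊤ := by simp [ENNReal.add_ne_top]
    rw [show ((n + 1 : ℕ) : ℝ≥0∞) = (n : ℝ≥0∞) + 1 by push_cast; ring]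
    exact ENNReal.inv_mul_cancel h1 h2⟩

/-- The set of accumulation (cluster) points of a sequence. -/
def accPts {Y : Type*} [TopologicalSpace Y] (u : ℕ → Y) : Set Y :=
  {p | MapClusterPt p atTop u}

/-- `μ` is a `T`-invariant probability measure. -/
def InvMeas {X : Type*} [MeasurableSpace X] (T : X → X) (μ : ProbabilityMeasure X) : Prop :=
  (μ : Measure X).map T = (μ : Measure X)

/-- Entropy `H_μ` of the refined partition `⋁_{j=0}^{m-1} T^{-j} P` determined by a
finite measurable partition coded by `P : X → Fin k`. -/
noncomputable def partitionH {X : Type*} [MeasurableSpace X] (T : X → X) (μ : Measure X)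
    {k : ℕ} (P : X → Fin k) (m : ℕ) : ℝ :=
  ∑ s : Fin m → Fin k,
    Real.negMulLog ((μ {x | ∀ j : Fin m, P (T^[(j : ℕ)] x) = s j}).toReal)

/-- Kolmogorov–Sinai (measure-theoretic) entropy `h(T,μ)`: the supremum over finite
measurable partitions of `lim_n (1/n) H_μ(⋁_{j<n} T^{-j}P)`; by subadditivity
(Fekete) the limit equals the infimum. -/
noncomputable def entropyKS {X : Type*} [MeasurableSpace X] (T : X → X) (μ : Measure X) :
    ℝ≥0∞ :=
  ⨆ (k : ℕ) (P : X → Fin k) (_ : Measurable P),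
    ⨅ n : ℕ, ENNReal.ofReal (partitionH T μ P (n + 1) / (n + 1))

/-- `Λ(y,φ) = sup { h(T,μ) + ∫ φ dμ : μ ∈ M(X,T), Ξ μ = y }`, with value `⊥ = -∞`
when no invariant measure is mapped to `y` by `Ξ`. -/
noncomputable def Lam {X Y : Type*} [MeasurableSpace X] (T : X → X)
    (Ξ : ProbabilityMeasure X → Y) (φ : X → ℝ) (y : Y) : EReal :=
  ⨆ (μ : ProbabilityMeasure X) (_ : InvMeas T μ ∧ Ξ μ = y),
    ((entropyKS T (μ : Measure X) : ℝ≥0∞) : EReal) + ((∫ x, φ x ∂(μ : Measure X) : ℝ) : EReal)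

end

/-- A critical-value estimate: if `Z` is covered infinitely often by families of Bowen balls of
cardinality `O(exp (N a))` on which `S_N φ ≤ N b`, then `P(Z, φ, ε) ≤ t` for every `t > a + b`. -/
theorem pressAt_le_of_covers {X : Type*} {D : X → X → ℝ} {T : X → X} {Z : Set X} {φ : X → ℝ}
    {ε M a b t : ℝ} (hlt : a + b < t) (E : ℕ → Finset X)
    (hcard : ∀ N, ((E N).card : ℝ) ≤ M * Real.exp (N * a))
    (hsup : ∀ N, ∀ x ∈ E N, sSup (birkhoffS T φ N '' bowenBallD D T x N ε) ≤ N * b)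
    (hcov : ∀ x ∈ Z, ∃ᶠ N in atTop, ∃ y ∈ E N, x ∈ bowenBallD D T y N ε) :
    pressAt D T Z φ ε ≤ t := by
  refine sInf_le ⟨t, rfl, ?_⟩
  rw [Mlim, ENNReal.iSup_eq_zero]
  intro n
  set ρ : ℝ := Real.exp (a + b - t) with hρ
  have hρ1 : ρ < 1 := by rw [hρ, Real.exp_lt_one_iff]; linarith
  set g : ℕ → ℝ≥0∞ := fun N => ENNReal.ofReal (M * ρ ^ N) with hg
  have hsum : ∑' N, g N ≠ ⊤ :=
    ((summable_geometric_of_lt_one (Real.exp_pos _).le hρ1).mul_left M).tsum_ofReal_ne_top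
  refine le_antisymm (ge_of_tendsto (ENNReal.tendsto_sum_nat_add g hsum) ?_) zero_le
  filter_upwards [eventually_ge_atTop n] with i hi
  set C : ℕ → Set (X × ℕ) := fun k => (fun x => (x, k + i)) '' (E (k + i) : Set X) with hC
  have hCok : covOK D T Z n ε (⋃ k, C k) := by
    refine ⟨countable_iUnion fun k => ((E (k + i)).countable_toSet.image _), ?_, ?_⟩
    · simp only [hC, mem_iUnion, mem_image]
      rintro p ⟨k, x, -, rfl⟩
      simp only
      omega
    · intro x hx
      obtain ⟨N, hN, y, hy, hxy⟩ := frequently_atTop.1 (hcov x hx) i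
      refine mem_iUnion₂.2 ⟨(y, N), mem_iUnion.2 ⟨N - i, y, ?_, ?_⟩, hxy⟩
      · rwa [Nat.sub_add_cancel hN]
      · simp [Nat.sub_add_cancel hN]
  refine (iInf₂_le _ hCok).trans ((ENNReal.tsum_iUnion_le_tsum (fun p : X × ℕ => ENNReal.ofReal
      (Real.exp (-t * (p.2 : ℝ) + sSup (birkhoffS T φ p.2 '' bowenBallD D T p.1 p.2 ε)))) C).trans
      (ENNReal.tsum_le_tsum fun k => ?_))
  rw [hC]
  simp only
  rw [tsum_image (g := fun x : X => (x, k + i)) (fun p : X × ℕ => ENNReal.ofReal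
      (Real.exp (-t * (p.2 : ℝ) + sSup (birkhoffS T φ p.2 '' bowenBallD D T p.1 p.2 ε))))
      (fun x _ y _ h => (Prod.ext_iff.1 h).1)]
  simp only
  rw [Finset.tsum_subtype' (E (k + i)) fun x => ENNReal.ofReal
      (Real.exp (-t * ((k + i : ℕ) : ℝ) +
        sSup (birkhoffS T φ (k + i) '' bowenBallD D T x (k + i) ε)))]
  generalize k + i = N
  calc _ ≤ ∑ _x ∈ E N, ENNReal.ofReal (Real.exp (N * (b - t))) := by
        refine Finset.sum_le_sum fun x hx => ENNReal.ofReal_le_ofReal (Real.exp_le_exp.2 ?_)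
        linarith [hsup N x hx]
    _ = ENNReal.ofReal ((E N).card * Real.exp (N * (b - t))) := by
        rw [Finset.sum_const, nsmul_eq_mul, ENNReal.ofReal_mul (by positivity),
          ENNReal.ofReal_natCast]
    _ ≤ g N := by
        refine ENNReal.ofReal_le_ofReal ?_
        calc _ ≤ M * Real.exp (N * a) * Real.exp (N * (b - t)) := by
              gcongr
              exact hcard N
          _ = M * ρ ^ N := by
              rw [hρ, ← Real.exp_nat_mul, mul_assoc, ← Real.exp_add]
              ring_nf

theorem exists_code_length {B : Type*} [Fintype B] [Nonempty B] (p : B → ℝ) (hp : ∀ s, 0 ≤ p s)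
    (hp1 : ∑ s, p s = 1) {δ : ℝ} (hδ : 0 < δ) :
    ∃ c : B → ℝ, (∀ s, 0 ≤ c s) ∧ ∑ s, Real.exp (-c s) = 1 ∧
      ∑ s, p s * c s ≤ ∑ s, Real.negMulLog (p s) + δ := by
  set n : ℝ := (Fintype.card B : ℝ)
  have hn : 0 < n := by simpa [n] using Fintype.card_pos
  set θ : ℝ := δ / n
  have hθ : 0 < θ := by positivity
  have hθn : θ * n = δ := by simp only [θ]; field_simp
  have hpos : ∀ s, 0 < (p s + θ) / (1 + δ) := fun s => by have := hp s; positivity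
  have hsum : ∑ s, (p s + θ) / (1 + δ) = 1 := by
    rw [← Finset.sum_div, Finset.sum_add_distrib, hp1, Finset.sum_const, nsmul_eq_mul,
      Finset.card_univ, mul_comm, hθn, div_self (by positivity)]
  refine ⟨fun s => -Real.log ((p s + θ) / (1 + δ)), fun s => ?_, ?_, ?_⟩
  · rw [neg_nonneg]
    refine Real.log_nonpos (hpos s).le ?_
    refine le_of_le_of_eq ?_ hsum
    exact Finset.single_le_sum (f := fun s => (p s + θ) / (1 + δ))
      (fun i _ => (hpos i).le) (Finset.mem_univ s)
  · simp only [neg_neg]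
    refine Eq.trans ?_ hsum
    exact Finset.sum_congr rfl fun s _ => Real.exp_log (hpos s)
  · calc _ ≤ ∑ s, (Real.negMulLog (p s) + p s * δ) := by
          refine Finset.sum_le_sum fun s _ => ?_
          rcases (hp s).eq_or_lt with h | h
          · simp [← h]
          · simp only
            rw [Real.log_div (by positivity) (by positivity), Real.negMulLog]
            have h1 : Real.log (p s) ≤ Real.log (p s + θ) := Real.log_le_log h (by linarith)
            have h2 : Real.log (1 + δ) ≤ δ := by
              linarith [Real.log_le_sub_one_of_pos (show 0 < 1 + δ by linarith)]
            nlinarith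
      _ = _ := by rw [Finset.sum_add_distrib, ← Finset.sum_mul, hp1, one_mul]

theorem sum_range_mul_eq_sum_residues (f : ℕ → ℝ) (m L : ℕ) :
    ∑ i ∈ Finset.range (m * L), f i =
      ∑ r ∈ Finset.range m, ∑ l ∈ Finset.range L, f (r + m * l) := by
  induction L with
  | zero => simp
  | succ L ih =>
    rw [Nat.mul_succ, Finset.sum_range_add, ih, ← Finset.sum_add_distrib]
    refine Finset.sum_congr rfl fun r _ => ?_
    rw [Finset.sum_range_succ, add_comm (m * L) r]

/-- The itinerary of length `m` of a point with respect to a partition coded by `P`. -/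
def itinerary {X κ : Type*} (T : X → X) (P : X → κ) (m : ℕ) (x : X) : Fin m → κ :=
  fun j => P (T^[j] x)

theorem exists_finset_representatives {X κ : Type*} [Fintype κ] (S : Set X) (f : X → κ) :
    ∃ E : Finset X, (E : Set X) ⊆ S ∧ InjOn f E ∧ ∀ y ∈ S, ∃ x ∈ E, f x = f y := by
  obtain ⟨E, hES, hE⟩ := SurjOn.exists_bijOn_subset (surjOn_image f S)
  have hfin : E.Finite := Finite.of_injOn (hE.mapsTo.mono_right (subset_univ _)) hE.injOn
    (toFinite (univ : Set κ))
  refine ⟨hfin.toFinset, by simpa using hES, by simpa using hE.injOn, fun y hy => ?_⟩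
  obtain ⟨x, hx, hxy⟩ := hE.surjOn (mem_image_of_mem f hy)
  exact ⟨x, by simpa using hx, hxy⟩

/-- Counting of itineraries: the points along whose orbit a block code of lengths `c` has average
length at most `A` realise at most `exp (N A / m)` itineraries of length `N`, up to a constant
factor. -/
theorem exists_finset_itinerary_cover {X κ : Type*} [Fintype κ] (T : X → X) (P : X → κ)
    {m : ℕ} (hm : 0 < m) (c : (Fin m → κ) → ℝ) (hc : ∀ s, 0 ≤ c s)
    (hc1 : ∑ s, Real.exp (-c s) = 1) {C : ℝ} (hC : ∀ s, c s ≤ C) (A : ℝ) (N : ℕ) (S : Set X)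
    (hS : ∀ x ∈ S, ∑ i ∈ Finset.range N, c (itinerary T P m (T^[i] x)) ≤ N * A) :
    ∃ E : Finset X, (E : Set X) ⊆ S ∧
      (E.card : ℝ) ≤ m * Fintype.card (Fin m → κ) * Real.exp C * Real.exp (N * (A / m)) ∧
      ∀ y ∈ S, ∃ x ∈ E, ∀ i < N, P (T^[i] x) = P (T^[i] y) := by
  classical
  set L : ℕ := N / m + 1 with hL
  have hNL : N ≤ m * L := by
    rw [hL, Nat.mul_succ]
    have := Nat.div_add_mod N m
    have := Nat.mod_lt N hm
    omega
  have hLN : m * L ≤ N + m := by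
    rw [hL, Nat.mul_succ]
    have := Nat.mul_div_le N m
    omega
  have hm0 : (0 : ℝ) < m := by exact_mod_cast hm
  set q : ℝ := N * (A / m) + C with hq
  have hres : ∀ x ∈ S, ∃ r : Fin m,
      ∑ l : Fin L, c (itinerary T P m (T^[r + m * l] x)) ≤ q := by
    intro x hx
    have h1 : ∑ i ∈ Finset.range (m * L), c (itinerary T P m (T^[i] x)) ≤ m * q := by
      obtain ⟨d, hd⟩ := Nat.exists_eq_add_of_le hNL
      rw [hd, Finset.sum_range_add]
      have hdm : (d : ℝ) ≤ m := by exact_mod_cast (by omega : d ≤ m)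
      have hC0 : 0 ≤ C := (hc _).trans (hC (itinerary T P m x))
      have h2 : ∑ i ∈ Finset.range d, c (itinerary T P m (T^[N + i] x)) ≤ m * C := by
        refine (Finset.sum_le_card_nsmul _ _ C fun i _ => hC _).trans ?_
        rw [Finset.card_range, nsmul_eq_mul]
        gcongr
      have h3 : (m : ℝ) * q = N * A + m * C := by rw [hq]; field_simp
      linarith [hS x hx]
    rw [sum_range_mul_eq_sum_residues, ← Fin.sum_univ_eq_sum_range
      (fun r => ∑ l ∈ Finset.range L, c (itinerary T P m (T^[r + m * l] x)))] at h1
    have : Nonempty (Fin m) := ⟨⟨0, hm⟩⟩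
    obtain ⟨r, -, hr⟩ := Finset.exists_le_of_sum_le (s := (Finset.univ : Finset (Fin m)))
      (g := fun _ => q) Finset.univ_nonempty (h1.trans (by simp))
    refine ⟨r, ?_⟩
    rwa [← Fin.sum_univ_eq_sum_range (fun l => c (itinerary T P m (T^[r + m * l] x)))] at hr
  have : Nonempty (Fin m) := ⟨⟨0, hm⟩⟩
  choose! r hr using hres
  set code : X → Fin m × (Fin m → κ) × (Fin L → Fin m → κ) := fun x =>
    (r x, itinerary T P m x, fun l => itinerary T P m (T^[r x + m * l] x)) with hcode
  obtain ⟨E, hES, hinj, hrep⟩ := exists_finset_representatives S code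
  refine ⟨E, hES, ?_, fun y hy => ?_⟩
  · have h1 : (E.card : ℝ) * Real.exp (-q) ≤ m * Fintype.card (Fin m → κ) := by
      set w : Fin m × (Fin m → κ) × (Fin L → Fin m → κ) → ℝ :=
        fun z => ∏ l, Real.exp (-c (z.2.2 l)) with hw
      have hw0 : ∀ z, 0 ≤ w z := fun z => Finset.prod_nonneg fun l _ => (Real.exp_pos _).le
      calc (E.card : ℝ) * Real.exp (-q) = ∑ _x ∈ E, Real.exp (-q) := by simp
        _ ≤ ∑ x ∈ E, w (code x) := by
            refine Finset.sum_le_sum fun x hx => ?_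
            rw [hw, hcode]
            simp only
            rw [← Real.exp_sum, Finset.sum_neg_distrib]
            exact Real.exp_le_exp.2 (neg_le_neg (hr x (hES hx)))
        _ = ∑ z ∈ E.image code, w z := (Finset.sum_image hinj).symm
        _ ≤ ∑ z, w z := Finset.sum_le_sum_of_subset_of_nonneg (Finset.subset_univ _)
            fun z _ _ => hw0 z
        _ = m * Fintype.card (Fin m → κ) := by
            have h2 : ∑ b : Fin L → Fin m → κ, ∏ l, Real.exp (-c (b l)) = 1 := by
              rw [← Fintype.sum_pow (fun s => Real.exp (-c s)), hc1, one_pow]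
            rw [hw, Fintype.sum_prod_type]
            simp_rw [Fintype.sum_prod_type, h2]
            simp
    rw [Real.exp_neg, ← div_eq_mul_inv, div_le_iff₀ (Real.exp_pos _)] at h1
    refine h1.trans_eq ?_
    rw [hq, Real.exp_add]
    ring
  · obtain ⟨x, hx, hxy⟩ := hrep y hy
    refine ⟨x, hx, fun i hi => ?_⟩
    simp only [hcode, Prod.mk.injEq] at hxy
    obtain ⟨h1, h2, h3⟩ := hxy
    by_cases hir : i < m
    · exact congrFun h2 ⟨i, hir⟩
    · have hrm := (r x).2
      set u := i - r x with hu
      have hl : u / m < L := by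
        rw [hL, Nat.lt_succ_iff]
        exact Nat.div_le_div_right (by omega)
      have h4 := congrFun (congrFun h3 ⟨u / m, hl⟩) ⟨u % m, Nat.mod_lt _ hm⟩
      simp only [itinerary, ← Function.iterate_add_apply, ← h1] at h4
      have h5 : u % m + (r x + m * (u / m)) = i := by
        have := Nat.mod_add_div u m
        omega
      rwa [h5] at h4

theorem measure_frontier_iInter_eq_zero {X ι : Type*} [TopologicalSpace X] [MeasurableSpace X]
    [Finite ι] {μ : Measure X} {A : ι → Set X} (h : ∀ i, μ (frontier (A i)) = 0) :
    μ (frontier (⋂ i, A i)) = 0 := by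
  refine measure_mono_null (fun x hx => ?_) (measure_iUnion_null h)
  rw [frontier, interior_iInter_of_finite, Set.mem_sdiff, mem_iInter, not_forall] at hx
  obtain ⟨hx, i, hi⟩ := hx
  exact mem_iUnion.2 ⟨i, closure_mono (iInter_subset A i) hx, hi⟩

/-- A compact metric space has finite measurable partitions of arbitrarily small mesh whose
atoms have null boundary. -/
theorem exists_partition_null_frontier {X : Type*} [MetricSpace X] [CompactSpace X]
    [MeasurableSpace X] [BorelSpace X] (μ : Measure X) [IsFiniteMeasure μ] {ε : ℝ} (hε : 0 < ε) :
    ∃ (k : ℕ) (P : X → Fin k), Measurable P ∧ (∀ x y, P x = P y → dist x y ≤ ε) ∧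
      ∀ s, μ (frontier (P ⁻¹' {s})) = 0 := by
  classical
  have hrad : ∀ x : X, ∃ r ∈ Ioo 0 (ε / 2), μ (frontier (Metric.ball x r)) = 0 := by
    intro x
    obtain ⟨r, hr, h⟩ := exists_null_frontier_thickening μ {x} (half_pos hε)
    exact ⟨r, hr, by rwa [Metric.thickening_singleton] at h⟩
  choose r hr hrμ using hrad
  obtain ⟨t, ht⟩ := isCompact_univ.elim_finite_subcover (fun x => Metric.ball x (r x))
    (fun x => Metric.isOpen_ball) (fun x _ => mem_iUnion.2 ⟨x, Metric.mem_ball_self (hr x).1⟩)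
  set f : X → t → Bool := fun x i => decide (x ∈ Metric.ball (i : X) (r i)) with hf
  have hfm : Measurable f := measurable_pi_iff.2 fun i =>
    measurable_to_bool (by
      convert! (Metric.isOpen_ball (x := (i : X)) (ε := r i)).measurableSet using 1
      ext x
      simp [hf])
  set e := Fintype.equivFin (t → Bool)
  refine ⟨_, fun x => e (f x), (measurable_of_finite e).comp hfm, fun x y hxy => ?_, fun s => ?_⟩
  · obtain ⟨i, hit, hx⟩ := mem_iUnion₂.1 (ht (mem_univ x))
    have h := congrFun (e.injective hxy) ⟨i, hit⟩
    have hy : y ∈ Metric.ball i (r i) := by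
      simpa [hf, Metric.mem_ball.1 hx] using h
    have := (hr i).2
    rw [Metric.mem_ball] at hx hy
    linarith [dist_triangle_right x y i]
  · have : (fun x => e (f x)) ⁻¹' {s} = ⋂ i : t, {x | f x i = e.symm s i} := by
      ext x
      simp only [mem_preimage, mem_singleton_iff, mem_iInter, mem_ofPred_eq]
      rw [← Equiv.eq_symm_apply, funext_iff]
    rw [this]
    refine measure_frontier_iInter_eq_zero fun i => ?_
    cases e.symm s i with
    | true =>
      have : {x | f x i = true} = Metric.ball (i : X) (r i) := by
        ext x
        simp [hf]
      rw [this]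
      exact hrμ i
    | false =>
      have : {x | f x i = false} = (Metric.ball (i : X) (r i))ᶜ := by
        ext x
        simp [hf]
      rw [this, frontier_compl]
      exact hrμ i

theorem measure_frontier_itinerary_eq_zero {X κ : Type*} [TopologicalSpace X] [MeasurableSpace X]
    [BorelSpace X] {T : X → X} (hT : Continuous T) {μ : Measure X}
    (hμ : MeasurePreserving T μ μ) {P : X → κ} (hP : ∀ s, μ (frontier (P ⁻¹' {s})) = 0) (m : ℕ)
    (s : Fin m → κ) : μ (frontier (itinerary T P m ⁻¹' {s})) = 0 := by
  have : itinerary T P m ⁻¹' {s} = ⋂ j : Fin m, T^[j] ⁻¹' (P ⁻¹' {s j}) := by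
    ext x
    simp [itinerary, funext_iff]
  rw [this]
  refine measure_frontier_iInter_eq_zero fun j => ?_
  refine measure_mono_null ((hT.iterate j).frontier_preimage_subset _) ?_
  rw [(hμ.iterate j).measure_preimage isClosed_frontier.measurableSet.nullMeasurableSet]
  exact hP _

theorem measurable_itinerary {X κ : Type*} [MeasurableSpace X] [MeasurableSpace κ] {T : X → X}
    (hT : Measurable T) {P : X → κ} (hP : Measurable P) (m : ℕ) :
    Measurable (itinerary T P m) :=
  measurable_pi_iff.2 fun j => hP.comp (hT.iterate j)

theorem integral_empPM {X : Type*} [MeasurableSpace X] (T : X → X) (x : X) (n : ℕ) {f : X → ℝ}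
    (hf : StronglyMeasurable f) (hfi : ∀ y, Integrable f (Measure.dirac y)) :
    ∫ y, f y ∂(empPM T x n : Measure X) =
      (∑ i ∈ Finset.range (n + 1), f (T^[i] x)) / (n + 1) := by
  have : (empPM T x n : Measure X) =
      ((n + 1 : ℝ≥0∞))⁻¹ • ∑ k ∈ Finset.range (n + 1), Measure.dirac (T^[k] x) := rfl
  rw [this, integral_smul_measure, integral_finsetSum_measure fun i _ => hfi _]
  simp_rw [integral_dirac' f _ hf]
  rw [smul_eq_mul, ENNReal.toReal_inv, div_eq_inv_mul]
  congr 2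

theorem tendsto_integral_comp_of_null_frontier {X B : Type*} [MetricSpace X] [MeasurableSpace X]
    [BorelSpace X] [Fintype B] [MeasurableSpace B] [MeasurableSingletonClass B]
    (μ : ProbabilityMeasure X) {f : X → B} (hf : Measurable f)
    (hfμ : ∀ s, (μ : Measure X) (frontier (f ⁻¹' {s})) = 0) (c : B → ℝ) :
    Tendsto (fun ν : ProbabilityMeasure X => ∫ x, c (f x) ∂(ν : Measure X)) (𝓝 μ)
      (𝓝 (∑ s, ((μ : Measure X) (f ⁻¹' {s})).toReal * c s)) := by
  have h : ∀ ν : ProbabilityMeasure X, ∫ x, c (f x) ∂(ν : Measure X) =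
      ∑ s, ((ν : Measure X) (f ⁻¹' {s})).toReal * c s := by
    intro ν
    rw [← integral_map hf.aemeasurable (measurable_of_finite c).aestronglyMeasurable]
    have := Measure.isProbabilityMeasure_map (μ := (ν : Measure X)) hf.aemeasurable
    rw [integral_fintype .of_finite]
    refine Finset.sum_congr rfl fun s _ => ?_
    rw [measureReal_def, Measure.map_apply hf (measurableSet_singleton s), smul_eq_mul]
  simp_rw [h]
  refine tendsto_finsetSum _ fun s _ => Tendsto.mul_const _ ?_
  exact (ENNReal.tendsto_toReal (measure_ne_top _ _)).comp
    (ProbabilityMeasure.tendsto_measure_of_null_frontier_of_tendsto' tendsto_id (hfμ s))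

/-- Bowen's estimate at a fixed scale: points whose empirical measures accumulate at the invariant
measure `μ` have pressure at most `h(T, μ) + ∫ φ dμ`, up to the oscillation of `φ`. -/
theorem pressAt_le_of_mapClusterPt {X : Type*} [MetricSpace X] [CompactSpace X]
    [MeasurableSpace X] [BorelSpace X] {T : X → X} (hT : Continuous T) {φ : X → ℝ}
    (hφ : Continuous φ) {μ : ProbabilityMeasure X} (hμ : InvMeas T μ) {h δ ε : ℝ} (hh : 0 ≤ h)
    (hent : entropyKS T (μ : Measure X) ≤ ENNReal.ofReal h) (hδ : 0 < δ) (hε : 0 < ε)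
    (hosc : ∀ x y, dist x y ≤ ε → φ y ≤ φ x + δ) {Z : Set X}
    (hZ : ∀ x ∈ Z, MapClusterPt μ atTop fun n => empPM T x n) :
    pressAt (fun a b => dist a b) T Z φ ε ≤
      ((h + ∫ x, φ x ∂(μ : Measure X) + 6 * δ : ℝ) : EReal) := by
  set I := ∫ x, φ x ∂(μ : Measure X)
  obtain ⟨k, P, hPm, hPε, hPμ⟩ := exists_partition_null_frontier (μ : Measure X) hε
  obtain ⟨n, hn⟩ : ∃ n : ℕ, partitionH T (μ : Measure X) P (n + 1) / (n + 1) < h + δ := by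
    have h1 : (⨅ n : ℕ, ENNReal.ofReal (partitionH T (μ : Measure X) P (n + 1) / (n + 1))) <
        ENNReal.ofReal (h + δ) := by
      refine lt_of_le_of_lt (le_trans ?_ hent)
        ((ENNReal.ofReal_lt_ofReal_iff (by linarith)).2 (by linarith))
      exact le_iSup_of_le k (le_iSup₂ (f := fun (P : X → Fin k) (_ : Measurable P) =>
        ⨅ n : ℕ, ENNReal.ofReal (partitionH T (μ : Measure X) P (n + 1) / (n + 1))) P hPm)
    obtain ⟨n, hn⟩ := iInf_lt_iff.1 h1
    exact ⟨n, (ENNReal.ofReal_lt_ofReal_iff (by linarith)).1 hn⟩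
  set m := n + 1 with hm
  have hm1 : (1 : ℝ) ≤ m := by simp [hm]
  set f := itinerary T P m
  have hfm : Measurable f := measurable_itinerary hT.measurable hPm m
  have hfμ : ∀ s, (μ : Measure X) (frontier (f ⁻¹' {s})) = 0 :=
    measure_frontier_itinerary_eq_zero hT ⟨hT.measurable, hμ⟩ hPμ m
  set p : (Fin m → Fin k) → ℝ := fun s => ((μ : Measure X) (f ⁻¹' {s})).toReal with hp
  have hp1 : ∑ s, p s = 1 := by
    have h1 := sum_measureReal_preimage_singleton (μ := (μ : Measure X)) (f := f) Finset.univ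
      fun s _ => hfm (measurableSet_singleton s)
    simpa [measureReal_def] using h1
  have hpH : ∑ s, Real.negMulLog (p s) = partitionH T (μ : Measure X) P m := by
    refine Finset.sum_congr rfl fun s _ => ?_
    have : f ⁻¹' {s} = {x | ∀ j : Fin m, P (T^[(j : ℕ)] x) = s j} := by
      ext x
      simp [f, itinerary, funext_iff]
    rw [hp, ← this]
  have hne : Nonempty (Fin m → Fin k) := by
    by_contra hcon
    rw [not_nonempty_iff] at hcon
    simp at hp1
  obtain ⟨c, hc0, hc1, hcp⟩ := exists_code_length p (fun s => ENNReal.toReal_nonneg) hp1 hδ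
  obtain ⟨C, hC⟩ := (finite_range c).bddAbove
  set A : ℝ := partitionH T (μ : Measure X) P m + 2 * δ with hA
  have hAm : A / m ≤ h + 3 * δ := by
    have h2 : 2 * δ / m ≤ 2 * δ := div_le_self (by linarith) hm1
    have h3 : partitionH T (μ : Measure X) P m / m < h + δ := by
      rw [hm]; push_cast; exact hn
    rw [hA, add_div]
    linarith
  set S : ℕ → Set X := fun N => {x | ∑ i ∈ Finset.range N, c (f (T^[i] x)) ≤ N * A ∧
    birkhoffS T φ N x ≤ N * (I + δ)} with hS
  choose E hES hcard hcov using fun N => exists_finset_itinerary_cover T P (Nat.succ_pos n) c hc0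
    hc1 (fun s => hC (mem_range_self s)) A N (S N) fun x hx => hx.1
  refine pressAt_le_of_covers (M := m * Fintype.card (Fin m → Fin k) * Real.exp C)
    (a := h + 3 * δ) (b := I + 2 * δ) (by linarith) E (fun N => ?_) (fun N x hx => ?_)
    fun x hx => ?_
  · refine (hcard N).trans ?_
    gcongr
  · refine csSup_le ⟨_, x, fun i _ => by simpa using hε.le, rfl⟩ ?_
    rintro _ ⟨y, hy, rfl⟩
    have h1 : birkhoffS T φ N y ≤ birkhoffS T φ N x + N * δ := by
      calc birkhoffS T φ N y ≤ ∑ i ∈ Finset.range N, (φ (T^[i] x) + δ) :=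
            Finset.sum_le_sum fun i hi => hosc _ _ (hy i (Finset.mem_range.1 hi))
        _ = _ := by simp [birkhoffS, Finset.sum_add_distrib]
    linarith [(hES N hx).2]
  · have hev : ∀ᶠ ν : ProbabilityMeasure X in 𝓝 μ,
        ∫ x, c (f x) ∂(ν : Measure X) < A ∧ ∫ x, φ x ∂(ν : Measure X) < I + δ := by
      refine ((tendsto_integral_comp_of_null_frontier μ hfm hfμ c).eventually_lt_const ?_).and
        (((ProbabilityMeasure.tendsto_iff_forall_integral_tendsto.1 tendsto_id)
          (BoundedContinuousFunction.mkOfCompact ⟨φ, hφ⟩)).eventually_lt_const ?_)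
      · rw [hpH] at hcp
        linarith
      · simpa [I] using hδ
    have hfreq := (hZ x hx).frequently hev
    refine (tendsto_add_atTop_nat 1).frequently (hfreq.mono fun N hN => ?_)
    have hcf : StronglyMeasurable fun x => c (f x) :=
      ((measurable_of_finite c).comp hfm).stronglyMeasurable
    rw [integral_empPM T x N hcf fun y => integrable_dirac' hcf (by simp),
      integral_empPM T x N hφ.stronglyMeasurable
        fun y => integrable_dirac' hφ.stronglyMeasurable (by simp),
      div_lt_iff₀ (by positivity), div_lt_iff₀ (by positivity)] at hN
    obtain ⟨y, hy, hyx⟩ := hcov (N + 1) x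
      ⟨by push_cast; linarith [hN.1], by rw [birkhoffS]; push_cast; linarith [hN.2]⟩
    exact ⟨y, hy, fun i hi => hPε _ _ (hyx i hi)⟩

/-- If `K ⊆ M(X,T)` is nonempty and closed, then for `G_K = {x : A(L_n x) = K}`,
`P(G_K, φ) ≤ inf_{μ ∈ K} (h(T,μ) + ∫ φ dμ)`. -/
theorem pressure_G_K_le_inf
    {X : Type*} [MetricSpace X] [CompactSpace X] [MeasurableSpace X] [BorelSpace X]
    (T : X → X) (hT : Continuous T) (φ : X → ℝ) (hφ : Continuous φ)
    (K : Set (ProbabilityMeasure X)) (hKne : K.Nonempty) (hKcl : IsClosed K)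
    (hKinv : K ⊆ {μ | InvMeas T μ}) :
    pressure T {x : X | (accPts fun n => empPM T x n) = K} φ ≤
      ⨅ μ ∈ K, (((entropyKS T (μ : Measure X) : ℝ≥0∞) : EReal) +
        ((∫ x, φ x ∂(μ : Measure X) : ℝ) : EReal)) := by
  refine le_iInf₂ fun μ hμ => ?_
  by_cases htop : entropyKS T (μ : Measure X) = ⊤
  · rw [htop, EReal.coe_ennreal_top, EReal.top_add_coe]
    exact le_top
  set h := (entropyKS T (μ : Measure X)).toReal with hh
  have hent : entropyKS T (μ : Measure X) = ENNReal.ofReal h := (ENNReal.ofReal_toReal htop).symm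
  have hh0 : 0 ≤ h := ENNReal.toReal_nonneg
  rw [hent, EReal.coe_ennreal_ofReal, max_eq_left hh0, ← EReal.coe_add]
  refine EReal.le_of_forall_lt_iff_le.1 fun z hz => ?_
  rw [EReal.coe_lt_coe_iff] at hz
  set δ := (z - (h + ∫ x, φ x ∂(μ : Measure X))) / 6 with hδ
  have hδ0 : 0 < δ := by rw [hδ]; linarith
  obtain ⟨η, hη, hosc⟩ := Metric.uniformContinuous_iff.1
    (CompactSpace.uniformContinuous_of_continuous hφ) δ hδ0
  refine limsup_le_of_le (by isBoundedDefault) ?_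
  filter_upwards [Ioo_mem_nhdsGT hη] with ε hε
  have hz' : z = h + ∫ x, φ x ∂(μ : Measure X) + 6 * δ := by rw [hδ]; ring
  rw [hz']
  refine pressAt_le_of_mapClusterPt hT hφ (hKinv hμ) hh0 hent.le hδ0 hε.1 (fun x y hxy => ?_)
    fun x hx => ?_
  · have := (abs_lt.1 (Real.dist_eq _ _ ▸ hosc (hxy.trans_lt hε.2))).1
    linarith
  · have hx' : (accPts fun n => empPM T x n) = K := hx
    rw [← hx'] at hμ
    exact hμ
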